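/- arXiv:math/0605012 — 2 statements merged into one kernel-verified Lean document; each statement's English description precedes it below -/
import Mathlib

section
/- Γ' ∩ SL(2,ℤ[i]) = Ξ₁₂; that is, a matrix g ∈ SL(2,ℂ) with Gaussian-integer entries satisfies that all entries of C(g) are Gaussian integers if and only if the entries of g reduce modulo (1+i) to !![1,0;0,1] or !![0,1;1,0]. -/
open Complex Matrix

noncomputable section

/-- `z ∈ ℤ[i] ⊆ ℂ`. -/
def IsGauss (z : ℂ) : Prop := ∃ a b : ℤ, z = (a : ℂ) + (b : ℂ) * Complex.I

/-- Divisibility in `ℤ[i]`. -/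
def GDvd (m z : ℂ) : Prop := ∃ k : ℂ, IsGauss k ∧ z = m * k

/-- Congruence modulo `m` in `ℤ[i]`. -/
def GCong (m z w : ℂ) : Prop := GDvd m (z - w)

/-- The matrix of the conjugation action of `g ∈ SL(2,ℂ)` on `sl₂(ℂ)` in the trace-form
orthonormal basis. -/
def CMat (g : Matrix (Fin 2) (Fin 2) ℂ) : Matrix (Fin 3) (Fin 3) ℂ :=
  !![(g 0 0 ^ 2 - g 1 0 ^ 2 + g 1 1 ^ 2 - g 0 1 ^ 2) / 2,
     Complex.I * (g 0 0 ^ 2 - g 1 0 ^ 2 + g 0 1 ^ 2 - g 1 1 ^ 2) / 2,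
     g 1 0 * g 1 1 - g 0 0 * g 0 1;
     Complex.I * (g 0 1 ^ 2 + g 1 1 ^ 2 - g 0 0 ^ 2 - g 1 0 ^ 2) / 2,
     (g 0 0 ^ 2 + g 1 0 ^ 2 + g 0 1 ^ 2 + g 1 1 ^ 2) / 2,
     Complex.I * (g 0 0 * g 0 1 + g 1 0 * g 1 1);
     -(g 0 0 * g 1 0) + g 0 1 * g 1 1,
     Complex.I * (g 0 0 * g 1 0 + g 0 1 * g 1 1),
     g 0 0 * g 1 1 + g 0 1 * g 1 0]

/-- `Γ' ⊆ SL(2,ℂ)`: the preimage under `C` of `SO(3,ℤ[i])`. -/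
def GammaSet : Set (Matrix (Fin 2) (Fin 2) ℂ) :=
  {g | g.det = 1 ∧ ∀ i j, IsGauss (CMat g i j)}

/-- `Ξ₁₂`: matrices of `SL(2,ℤ[i])` reducing mod `1+i` to `!![1,0;0,1]` or `!![0,1;1,0]`. -/
def Xi12 : Set (Matrix (Fin 2) (Fin 2) ℂ) :=
  {g | (∀ i j, IsGauss (g i j)) ∧ g.det = 1 ∧
    ((GCong (1 + Complex.I) (g 0 0) 1 ∧ GCong (1 + Complex.I) (g 0 1) 0 ∧
      GCong (1 + Complex.I) (g 1 0) 0 ∧ GCong (1 + Complex.I) (g 1 1) 1) ∨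
     (GCong (1 + Complex.I) (g 0 0) 0 ∧ GCong (1 + Complex.I) (g 0 1) 1 ∧
      GCong (1 + Complex.I) (g 1 0) 1 ∧ GCong (1 + Complex.I) (g 1 1) 0))}

theorem isGauss_mk (x y : ℤ) : IsGauss ((x : ℂ) + (y : ℂ) * Complex.I) := ⟨x, y, rfl⟩

theorem isGauss_I : IsGauss Complex.I := ⟨0, 1, by simp⟩

theorem IsGauss.add {z w : ℂ} (hz : IsGauss z) (hw : IsGauss w) : IsGauss (z + w) := by
  obtain ⟨a, b, rfl⟩ := hz
  obtain ⟨c, d, rfl⟩ := hw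
  exact ⟨a + c, b + d, by push_cast; ring⟩

theorem IsGauss.neg {z : ℂ} (hz : IsGauss z) : IsGauss (-z) := by
  obtain ⟨a, b, rfl⟩ := hz
  exact ⟨-a, -b, by push_cast; ring⟩

theorem IsGauss.sub {z w : ℂ} (hz : IsGauss z) (hw : IsGauss w) : IsGauss (z - w) :=
  sub_eq_add_neg z w ▸ hz.add hw.neg

theorem IsGauss.mul {z w : ℂ} (hz : IsGauss z) (hw : IsGauss w) : IsGauss (z * w) := by
  obtain ⟨a, b, rfl⟩ := hz
  obtain ⟨c, d, rfl⟩ := hw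
  refine ⟨a * c - b * d, a * d + b * c, ?_⟩
  push_cast
  linear_combination (b * d : ℂ) * Complex.I_sq

theorem IsGauss.sq {z : ℂ} (hz : IsGauss z) : IsGauss (z ^ 2) :=
  pow_two z ▸ hz.mul hz

theorem int_add_mul_I_inj {x y u v : ℤ} :
    (x : ℂ) + (y : ℂ) * Complex.I = (u : ℂ) + (v : ℂ) * Complex.I ↔ x = u ∧ y = v := by
  simp [Complex.ext_iff]

theorem gDvd_one_add_I_iff {x y : ℤ} :
    GDvd (1 + Complex.I) ((x : ℂ) + (y : ℂ) * Complex.I) ↔ Even (x + y) := by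
  have expand (c d : ℤ) : (1 + Complex.I) * ((c : ℂ) + (d : ℂ) * Complex.I) =
      ((c - d : ℤ) : ℂ) + ((c + d : ℤ) : ℂ) * Complex.I := by
    push_cast
    linear_combination (d : ℂ) * Complex.I_sq
  constructor
  · rintro ⟨_, ⟨c, d, rfl⟩, h⟩
    rw [expand, int_add_mul_I_inj] at h
    exact ⟨c, by lia⟩
  · rintro ⟨c, hc⟩
    refine ⟨_, isGauss_mk c (y - c), ?_⟩
    rw [expand, int_add_mul_I_inj]
    lia

theorem gCong_one_add_I_zero_iff {x y : ℤ} :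
    GCong (1 + Complex.I) ((x : ℂ) + (y : ℂ) * Complex.I) 0 ↔ Even (x + y) := by
  rw [GCong, sub_zero, gDvd_one_add_I_iff]

theorem gCong_one_add_I_one_iff {x y : ℤ} :
    GCong (1 + Complex.I) ((x : ℂ) + (y : ℂ) * Complex.I) 1 ↔ ¬ Even (x + y) := by
  have h : (x : ℂ) + (y : ℂ) * Complex.I - 1 = ((x - 1 : ℤ) : ℂ) + (y : ℂ) * Complex.I := by
    push_cast
    ring
  rw [GCong, h, gDvd_one_add_I_iff]
  grind

theorem isGauss_half_iff {x y : ℤ} :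
    IsGauss (((x : ℂ) + (y : ℂ) * Complex.I) / 2) ↔ Even x ∧ Even y := by
  constructor
  · rintro ⟨c, d, h⟩
    have h' : (x : ℂ) + (y : ℂ) * Complex.I =
        ((c + c : ℤ) : ℂ) + ((d + d : ℤ) : ℂ) * Complex.I := by
      push_cast
      linear_combination 2 * h
    rw [int_add_mul_I_inj] at h'
    exact ⟨⟨c, h'.1⟩, ⟨d, h'.2⟩⟩
  · rintro ⟨⟨c, rfl⟩, ⟨d, rfl⟩⟩
    exact ⟨c, d, by push_cast; ring⟩

/-- For a Gaussian matrix, integrality of `C(g)` is decided by its central entry. -/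
theorem isGauss_CMat_iff {g : Matrix (Fin 2) (Fin 2) ℂ} (hg : ∀ i j, IsGauss (g i j)) :
    (∀ i j, IsGauss (CMat g i j)) ↔ IsGauss (CMat g 1 1) := by
  refine ⟨fun h => h 1 1, fun h => ?_⟩
  have ha := hg 0 0
  have hb := hg 0 1
  have hc := hg 1 0
  have hd := hg 1 1
  simp only [CMat, of_apply, cons_val', cons_val_one, cons_val_zero, cons_val_fin_one] at h
  intro i j
  fin_cases i <;> fin_cases j <;> simp only [CMat, of_apply, cons_val', cons_val, Fin.zero_eta,
    Fin.mk_one, Fin.reduceFinMk, cons_val_fin_one]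
  · convert h.sub (hc.sq.add hb.sq) using 1
    ring
  · convert isGauss_I.mul (h.sub (hc.sq.add hd.sq)) using 1
    ring
  · exact (hc.mul hd).sub (ha.mul hb)
  · convert isGauss_I.mul (h.sub (ha.sq.add hc.sq)) using 1
    ring
  · exact h
  · exact isGauss_I.mul ((ha.mul hb).add (hc.mul hd))
  · exact (ha.mul hc).neg.add (hb.mul hd)
  · exact isGauss_I.mul ((ha.mul hc).add (hb.mul hd))
  · exact (ha.mul hd).add (hb.mul hc)

theorem isGauss_half_sum_sq_iff (a₁ a₂ b₁ b₂ c₁ c₂ d₁ d₂ : ℤ) :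
    IsGauss ((((a₁ : ℂ) + a₂ * Complex.I) ^ 2 + ((c₁ : ℂ) + c₂ * Complex.I) ^ 2 +
      ((b₁ : ℂ) + b₂ * Complex.I) ^ 2 + ((d₁ : ℂ) + d₂ * Complex.I) ^ 2) / 2) ↔
      Even ((a₁ + a₂) + (b₁ + b₂) + (c₁ + c₂) + (d₁ + d₂)) := by
  have h : ((a₁ : ℂ) + a₂ * Complex.I) ^ 2 + ((c₁ : ℂ) + c₂ * Complex.I) ^ 2 +
      ((b₁ : ℂ) + b₂ * Complex.I) ^ 2 + ((d₁ : ℂ) + d₂ * Complex.I) ^ 2 =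
      ((a₁ ^ 2 - a₂ ^ 2 + (b₁ ^ 2 - b₂ ^ 2) + (c₁ ^ 2 - c₂ ^ 2) + (d₁ ^ 2 - d₂ ^ 2) : ℤ) : ℂ) +
      ((2 * (a₁ * a₂ + b₁ * b₂ + c₁ * c₂ + d₁ * d₂) : ℤ) : ℂ) * Complex.I := by
    push_cast
    linear_combination (a₂ ^ 2 + b₂ ^ 2 + c₂ ^ 2 + d₂ ^ 2 : ℂ) * Complex.I_sq
  rw [h, isGauss_half_iff]
  simp [Int.even_add, Int.even_sub, Int.even_pow]

/-- The reduction modulo `1 + i` of a Gaussian determinant-one relation. -/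
theorem odd_of_det_eq_one {a₁ a₂ b₁ b₂ c₁ c₂ d₁ d₂ : ℤ}
    (h : ((a₁ : ℂ) + a₂ * Complex.I) * ((d₁ : ℂ) + d₂ * Complex.I) -
      ((b₁ : ℂ) + b₂ * Complex.I) * ((c₁ : ℂ) + c₂ * Complex.I) = 1) :
    Odd ((a₁ + a₂) * (d₁ + d₂) - (b₁ + b₂) * (c₁ + c₂)) := by
  have h' : ((a₁ * d₁ - a₂ * d₂ - (b₁ * c₁ - b₂ * c₂) : ℤ) : ℂ) +
      ((a₁ * d₂ + a₂ * d₁ - (b₁ * c₂ + b₂ * c₁) : ℤ) : ℂ) * Complex.I =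
      ((1 : ℤ) : ℂ) + ((0 : ℤ) : ℂ) * Complex.I := by
    push_cast
    linear_combination h - (a₂ * d₂ - b₂ * c₂ : ℂ) * Complex.I_sq
  obtain ⟨hre, him⟩ := int_add_mul_I_inj.mp h'
  exact ⟨a₂ * d₂ - b₂ * c₂, by linear_combination hre + him⟩

/-- `Γ' ∩ SL(2,ℤ[i]) = Ξ₁₂`: a matrix `g ∈ SL(2,ℂ)` with Gaussian-integer entries has all
entries of `C(g)` Gaussian iff `g` reduces mod `1+i` to `!![1,0;0,1]` or `!![0,1;1,0]`. -/
theorem stmt4 :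
    {g : Matrix (Fin 2) (Fin 2) ℂ | g ∈ GammaSet ∧ ∀ i j, IsGauss (g i j)} = Xi12 := by
  ext g
  simp only [GammaSet, Xi12, Set.mem_ofPred_eq]
  rw [and_comm, and_congr_right_iff]
  intro hg
  rw [and_congr_right_iff]
  intro hdet
  rw [isGauss_CMat_iff hg]
  obtain ⟨a₁, a₂, ha⟩ := hg 0 0
  obtain ⟨b₁, b₂, hb⟩ := hg 0 1
  obtain ⟨c₁, c₂, hc⟩ := hg 1 0
  obtain ⟨d₁, d₂, hd⟩ := hg 1 1
  rw [det_fin_two, ha, hb, hc, hd] at hdet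
  have hodd := odd_of_det_eq_one hdet
  simp only [CMat, of_apply, cons_val', cons_val_one, cons_val_zero, cons_val_fin_one]
  rw [ha, hb, hc, hd, isGauss_half_sum_sq_iff]
  simp only [gCong_one_add_I_zero_iff, gCong_one_add_I_one_iff]
  generalize a₁ + a₂ = a at *
  generalize b₁ + b₂ = b at *
  generalize c₁ + c₂ = c at *
  generalize d₁ + d₂ = d at *
  rw [← Int.not_even_iff_odd, Int.even_sub, Int.even_mul, Int.even_mul] at hodd
  simp only [Int.even_add]
  tauto
end
end

section
/- Let n ≥ 2 be an integer, and set m = n − 2 if n ≥ 4 and m = n − 1 if n ∈ {2,3}. For every Gaussian integer u not divisible by 1+i, one has (1+i)^n ∣ u² − 1 if and only if (1+i)^m ∣ u − 1 or (1+i)^m ∣ u + 1. (This describes the kernel of the squaring endomorphism of the unit group of ℤ[i]/((1+i)^n).) -/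
open Complex

noncomputable section

theorem sq_sub_one_pow_dvd_iff {R : Type*} [CommRing R] [IsDomain R] {p e : R} (hp : Prime p)
    (he : (2 : R) = p ^ 2 * e) (hpe : ¬ p ∣ e) (hres : ∀ x : R, p ∣ x ∨ p ∣ x + 1)
    (n : ℕ) (hn : 2 ≤ n) (u : R) (hu : ¬ p ∣ u) :
    p ^ n ∣ u ^ 2 - 1 ↔
      (p ^ (if 4 ≤ n then n - 2 else n - 1) ∣ u - 1 ∨
       p ^ (if 4 ≤ n then n - 2 else n - 1) ∣ u + 1) := by
  have hp2 : p ∣ 2 := ⟨p * e, by rw [he]; ring⟩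
  obtain ⟨a, ha⟩ : p ∣ u - 1 := by
    have h := dvd_sub ((hres u).resolve_left hu) hp2
    have h' : u + 1 - 2 = u - 1 := by ring
    rwa [h'] at h
  have hu1 : u + 1 = p * (a + p * e) := by linear_combination ha + he
  have husq : u ^ 2 - 1 = (u - 1) * (u + 1) := by ring
  by_cases hpa : p ∣ a
  · obtain ⟨b, rfl⟩ := hpa
    have h1 : u - 1 = p ^ 2 * b := by rw [ha]; ring
    have h2 : u + 1 = p ^ 2 * (b + e) := by rw [hu1]; ring
    have h3 : u ^ 2 - 1 = p ^ 4 * (b * (b + e)) := by rw [husq, h1, h2]; ring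
    rw [h1, h2, h3]
    by_cases h5 : 5 ≤ n
    · obtain ⟨k, rfl⟩ := Nat.exists_eq_add_of_le h5
      have hm : (if 4 ≤ 5 + k then 5 + k - 2 else 5 + k - 1) = 2 + (k + 1) := by
        split_ifs <;> omega
      have hn' : 5 + k = 4 + (k + 1) := by omega
      rw [hm, hn', pow_add p 4, pow_add p 2, mul_dvd_mul_iff_left (pow_ne_zero _ hp.ne_zero),
        mul_dvd_mul_iff_left (pow_ne_zero _ hp.ne_zero),
        mul_dvd_mul_iff_left (pow_ne_zero _ hp.ne_zero)]
      constructor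
      · intro h
        by_cases hb : p ∣ b
        · exact Or.inl (hp.pow_dvd_of_dvd_mul_right _
            (fun hbe => hpe ((dvd_add_right hb).1 hbe)) h)
        · exact Or.inr (hp.pow_dvd_of_dvd_mul_left _ hb h)
      · rintro (h | h)
        · exact h.mul_right _
        · exact h.mul_left _
    · have hm : (if 4 ≤ n then n - 2 else n - 1) ≤ 2 := by split_ifs <;> omega
      exact iff_of_true ((pow_dvd_pow p (by omega)).mul_right _)
        (Or.inl ((pow_dvd_pow p hm).mul_right _))
  · have hpa' : ¬ p ∣ a + p * e := fun h => hpa ((dvd_add_left (dvd_mul_right p e)).1 h)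
    by_cases h3 : 3 ≤ n
    · have hm : 2 ≤ (if 4 ≤ n then n - 2 else n - 1) := by split_ifs <;> omega
      have key : ∀ x : R, ¬ p ∣ x → ∀ j i : ℕ, j + 1 ≤ i → ¬ p ^ i ∣ p ^ j * x := by
        intro x hx j i hij h
        have h' := (pow_dvd_pow p hij).trans h
        rw [pow_succ, mul_dvd_mul_iff_left (pow_ne_zero _ hp.ne_zero)] at h'
        exact hx h'
      refine iff_of_false ?_ ?_
      · have hsq : u ^ 2 - 1 = p ^ 2 * (a * (a + p * e)) := by rw [husq, ha, hu1]; ring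
        rw [hsq]
        exact key _ (fun h => (hp.dvd_or_dvd h).elim hpa hpa') 2 n h3
      · rw [ha, hu1, ← pow_one p, not_or]
        simp only [← pow_mul, one_mul]
        exact ⟨key _ hpa 1 _ hm, key _ (by simpa using hpa') 1 _ hm⟩
    · obtain rfl : n = 2 := by omega
      refine iff_of_true ?_ (Or.inl ?_)
      · rw [husq, ha, hu1, sq]
        exact mul_dvd_mul (dvd_mul_right _ _) (dvd_mul_right _ _)
      · simp [ha]

theorem isGauss_iff {z : ℂ} : IsGauss z ↔ ∃ x : GaussianInt, GaussianInt.toComplex x = z := by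
  constructor
  · rintro ⟨a, b, rfl⟩
    exact ⟨⟨a, b⟩, GaussianInt.toComplex_def' a b⟩
  · rintro ⟨x, rfl⟩
    exact ⟨x.re, x.im, GaussianInt.toComplex_def x⟩

theorem gDvd_toComplex_iff {x y : GaussianInt} :
    GDvd (GaussianInt.toComplex x) (GaussianInt.toComplex y) ↔ x ∣ y := by
  constructor
  · rintro ⟨k, hk, h⟩
    obtain ⟨c, rfl⟩ := isGauss_iff.1 hk
    exact ⟨c, GaussianInt.toComplex_inj.1 (by rw [h, map_mul])⟩
  · rintro ⟨c, rfl⟩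
    exact ⟨_, isGauss_iff.2 ⟨c, rfl⟩, map_mul _ _ _⟩

theorem GaussianInt.one_add_i_dvd_iff (x : GaussianInt) :
    (⟨1, 1⟩ : GaussianInt) ∣ x ↔ (2 : ℤ) ∣ x.re + x.im := by
  constructor
  · rintro ⟨c, rfl⟩
    exact ⟨c.re, by simp only [Zsqrtd.re_mul, Zsqrtd.im_mul]; ring⟩
  · rintro ⟨c, hc⟩
    refine ⟨⟨c, c - x.re⟩, ?_⟩
    ext
    · simp
    · simp only [Zsqrtd.im_mul]
      linarith

theorem GaussianInt.prime_one_add_i : Prime (⟨1, 1⟩ : GaussianInt) := by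
  refine ⟨by decide, fun h => ?_, fun x y h => ?_⟩
  · have h1 := (GaussianInt.one_add_i_dvd_iff 1).1 h.dvd
    norm_num at h1
  · rw [GaussianInt.one_add_i_dvd_iff] at h ⊢
    rw [GaussianInt.one_add_i_dvd_iff, ← Int.prime_two.dvd_mul]
    obtain ⟨c, hc⟩ := h
    simp only [Zsqrtd.re_mul, Zsqrtd.im_mul] at hc
    exact ⟨c + x.im * y.im, by linear_combination hc⟩

/-- Kernel of the squaring map on units of `ℤ[i]/((1+i)^n)`: for `n ≥ 2`, setting
`m = n − 2` if `n ≥ 4` and `m = n − 1` if `n ∈ {2,3}`, a Gaussian integer `u` not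
divisible by `1+i` satisfies `(1+i)^n ∣ u² − 1` iff `(1+i)^m ∣ u − 1` or
`(1+i)^m ∣ u + 1`. -/
theorem stmt7 (n : ℕ) (hn : 2 ≤ n) (u : ℂ) (hu : IsGauss u)
    (hnd : ¬ GDvd (1 + Complex.I) u) :
    GDvd ((1 + Complex.I) ^ n) (u ^ 2 - 1) ↔
      (GDvd ((1 + Complex.I) ^ (if 4 ≤ n then n - 2 else n - 1)) (u - 1) ∨
       GDvd ((1 + Complex.I) ^ (if 4 ≤ n then n - 2 else n - 1)) (u + 1)) := by
  obtain ⟨x, rfl⟩ := isGauss_iff.1 hu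
  have hp : (1 + Complex.I) = GaussianInt.toComplex ⟨1, 1⟩ := by
    simp [GaussianInt.toComplex_def]
  have h1 : GaussianInt.toComplex x ^ 2 - 1 = GaussianInt.toComplex (x ^ 2 - 1) := by simp
  have h2 : GaussianInt.toComplex x - 1 = GaussianInt.toComplex (x - 1) := by simp
  have h3 : GaussianInt.toComplex x + 1 = GaussianInt.toComplex (x + 1) := by simp
  rw [hp, gDvd_toComplex_iff] at hnd
  rw [h1, h2, h3, hp, ← map_pow, ← map_pow, gDvd_toComplex_iff, gDvd_toComplex_iff,
    gDvd_toComplex_iff]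
  refine sq_sub_one_pow_dvd_iff (e := ⟨0, -1⟩) GaussianInt.prime_one_add_i (by decide) ?_ ?_
    n hn x hnd
  · rw [GaussianInt.one_add_i_dvd_iff]
    norm_num
  · intro y
    rw [GaussianInt.one_add_i_dvd_iff, GaussianInt.one_add_i_dvd_iff]
    simp only [Zsqrtd.re_add, Zsqrtd.im_add, Zsqrtd.re_one, Zsqrtd.im_one]
    omega
end
end
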